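/- Consider the Lion-φ ODE with zero weight decay (λ = 0): ẋ_t = ∇φ(m̃_t) with m̃_t = m_t − ε(α∇f(x_t) + γ m_t), ṁ_t = −α∇f(x_t) − γ m_t, where α, γ, ε > 0, εγ ≤ 1, and ∇φ*(0) = 0. Define H(x,m) = α f(x) + (1 − εγ) φ(m). Then along any solution, −(d/dt) H(x_t, m_t) = γ ∇φ(m̃_t)ᵀ m̃_t + ((1−εγ)/ε) (m̃_t − m_t)ᵀ(∇φ(m̃_t) − ∇φ(m_t)) ≥ 0. -/

import Mathlib

open scoped RealInnerProductSpace

/-- The convex (Fenchel) conjugate `φ*(y) = sup_z (yᵀz − φ(z))`,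
valued in the extended reals. -/
noncomputable def fenchelConj {d : ℕ} (φ : EuclideanSpace ℝ (Fin d) → ℝ)
    (y : EuclideanSpace ℝ (Fin d)) : EReal :=
  ⨆ z : EuclideanSpace ℝ (Fin d), ((⟪y, z⟫ - φ z : ℝ) : EReal)

/-- First-order characterization of convexity: the graph of a convex function lies above its
tangent hyperplanes. -/
lemma ConvexOn.add_inner_gradient_le {E : Type*} [NormedAddCommGroup E] [InnerProductSpace ℝ E]
    [CompleteSpace E] {φ : E → ℝ} {g z : E} (hconv : ConvexOn ℝ Set.univ φ)
    (hg : HasGradientAt φ g z) (w : E) : φ z + ⟪g, w - z⟫ ≤ φ w := by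
  have hc : ConvexOn ℝ Set.univ (φ ∘ AffineMap.lineMap (k := ℝ) z w) := by
    simpa using hconv.comp_affineMap (AffineMap.lineMap (k := ℝ) z w)
  have hd : HasDerivAt (φ ∘ AffineMap.lineMap (k := ℝ) z w) ⟪g, w - z⟫ 0 := by
    have hz : HasGradientAt φ g (AffineMap.lineMap (k := ℝ) z w (0 : ℝ)) := by simpa using hg
    simpa using hz.hasFDerivAt.comp_hasDerivAt (0 : ℝ) AffineMap.hasDerivAt_lineMap
  have h := hc.le_slope_of_hasDerivAt (Set.mem_univ 0) (Set.mem_univ 1) zero_lt_one hd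
  simp only [slope_def_field, Function.comp_apply, AffineMap.lineMap_apply_zero,
    AffineMap.lineMap_apply_one, sub_zero, div_one] at h
  linarith

/-- The gradient of a convex function is a monotone map. -/
lemma ConvexOn.inner_sub_gradient_sub_nonneg {E : Type*} [NormedAddCommGroup E]
    [InnerProductSpace ℝ E] [CompleteSpace E] {φ : E → ℝ} {g h z w : E}
    (hconv : ConvexOn ℝ Set.univ φ) (hg : HasGradientAt φ g z) (hh : HasGradientAt φ h w) :
    0 ≤ ⟪z - w, g - h⟫ := by
  have h₁ := hconv.add_inner_gradient_le hg w
  have h₂ := hconv.add_inner_gradient_le hh z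
  rw [real_inner_comm]
  simp only [inner_sub_left, inner_sub_right] at *
  linarith

/-- If the conjugate of a convex function is minimal at `0`, then every gradient of the function
pairs nonnegatively with its base point. -/
lemma inner_gradient_self_nonneg_of_fenchelConj_zero_le {d : ℕ}
    {φ : EuclideanSpace ℝ (Fin d) → ℝ} {g z : EuclideanSpace ℝ (Fin d)}
    (hconv : ConvexOn ℝ Set.univ φ) (hg : HasGradientAt φ g z)
    (h0 : fenchelConj φ 0 ≤ fenchelConj φ g) : 0 ≤ ⟪g, z⟫ := by
  have hlow : ((⟪0, z⟫ - φ z : ℝ) : EReal) ≤ fenchelConj φ 0 :=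
    le_iSup (fun y : EuclideanSpace ℝ (Fin d) => ((⟪0, y⟫ - φ y : ℝ) : EReal)) z
  have hupp : fenchelConj φ g ≤ ((⟪g, z⟫ - φ z : ℝ) : EReal) := by
    refine iSup_le fun y => EReal.coe_le_coe_iff.2 ?_
    have h := hconv.add_inner_gradient_le hg y
    rw [inner_sub_right] at h
    linarith
  have h := EReal.coe_le_coe_iff.1 (hlow.trans (h0.trans hupp))
  rw [inner_zero_left] at h
  linarith

/-- Lion-φ without weight decay, `λ = 0`: for the ODE
`ẋ = ∇φ(m̃)`, `ṁ = −α∇f(x) − γm`, with `m̃ = m − ε(α∇f(x) + γm)`, `α, γ, ε > 0`,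
`εγ ≤ 1`, and `∇φ*(0) = 0` (encoded as: `0` is a subgradient of `φ*` at `0`,
i.e. `φ*` attains its minimum at `0`), the Lyapunov function
`H(x,m) = α f(x) + (1−εγ) φ(m)` satisfies
`−(d/dt) H(x_t,m_t) = γ ∇φ(m̃_t)ᵀm̃_t
  + ((1−εγ)/ε)(m̃_t − m_t)ᵀ(∇φ(m̃_t) − ∇φ(m_t)) ≥ 0`. -/
theorem lion_no_weight_decay {d : ℕ}
    (φ f : EuclideanSpace ℝ (Fin d) → ℝ)
    (φ' f' : EuclideanSpace ℝ (Fin d) → EuclideanSpace ℝ (Fin d))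
    (hconv : ConvexOn ℝ Set.univ φ)
    (hφ' : ∀ z, HasGradientAt φ (φ' z) z)
    (hf' : ∀ z, HasGradientAt f (f' z) z) (hf'c : Continuous f')
    (h0 : ∀ w, fenchelConj φ (0 : EuclideanSpace ℝ (Fin d)) ≤ fenchelConj φ w)
    (α γ ε : ℝ) (hα : 0 < α) (hγ : 0 < γ) (hε : 0 < ε) (hεγ : ε * γ ≤ 1)
    (x m : ℝ → EuclideanSpace ℝ (Fin d))
    (hx : ∀ t, HasDerivAt x (φ' (m t - ε • (α • f' (x t) + γ • m t))) t)
    (hm : ∀ t, HasDerivAt m (-(α • f' (x t)) - γ • m t) t) :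
    ∀ t : ℝ,
      HasDerivAt (fun τ => α * f (x τ) + (1 - ε * γ) * φ (m τ))
        (-(γ * ⟪φ' (m t - ε • (α • f' (x t) + γ • m t)),
              m t - ε • (α • f' (x t) + γ • m t)⟫
          + ((1 - ε * γ) / ε) *
              ⟪(m t - ε • (α • f' (x t) + γ • m t)) - m t,
                φ' (m t - ε • (α • f' (x t) + γ • m t)) - φ' (m t)⟫)) t
      ∧ 0 ≤ γ * ⟪φ' (m t - ε • (α • f' (x t) + γ • m t)),
              m t - ε • (α • f' (x t) + γ • m t)⟫
          + ((1 - ε * γ) / ε) *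
              ⟪(m t - ε • (α • f' (x t) + γ • m t)) - m t,
                φ' (m t - ε • (α • f' (x t) + γ • m t)) - φ' (m t)⟫ := by
  intro t
  refine ⟨?_, ?_⟩
  · have hfx := (hf' (x t)).hasFDerivAt.comp_hasDerivAt t (hx t)
    have hφm := (hφ' (m t)).hasFDerivAt.comp_hasDerivAt t (hm t)
    refine ((hfx.const_mul α).add (hφm.const_mul (1 - ε * γ))).congr_deriv ?_
    generalize φ' (m t - ε • (α • f' (x t) + γ • m t)) = p
    simp only [InnerProductSpace.toDual_apply_apply, inner_sub_right, inner_add_right,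
      inner_smul_right, inner_neg_right, real_inner_comm p, real_inner_comm (φ' (m t))]
    field_simp
    ring
  · have hself := inner_gradient_self_nonneg_of_fenchelConj_zero_le hconv
      (hφ' (m t - ε • (α • f' (x t) + γ • m t))) (h0 _)
    have hmono := hconv.inner_sub_gradient_sub_nonneg
      (hφ' (m t - ε • (α • f' (x t) + γ • m t))) (hφ' (m t))
    have hcoef : 0 ≤ (1 - ε * γ) / ε := div_nonneg (sub_nonneg.2 hεγ) hε.le
    exact add_nonneg (mul_nonneg hγ.le hself) (mul_nonneg hcoef hmono)
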